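/- Let Δ ≥ 2 be an integer and run the algorithm ⌈√Δ⌉-DOMINATE on a connected finite simple graph G on n vertices of maximum degree at most Δ, revealed in an order whose prefixes all induce connected subgraphs. Call a selected vertex v_i heavy if |N(v_i) ∩ U_i| ≥ ⌈√Δ⌉, and let H denote the set of heavy selected vertices. Then |H| ≤ (√Δ + 1/√Δ)·γ(G). -/

import Mathlib

open SimpleGraph

attribute [local instance] Classical.propDecidable

/-- `D` is a dominating set of `G`: every vertex is in `D` or adjacent to a member of `D`. -/
def IsDomSet {V : Type*} (G : SimpleGraph V) (D : Set V) : Prop :=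
  ∀ v : V, v ∈ D ∨ ∃ u ∈ D, G.Adj u v

/-- The domination number `γ(G)`: the minimum size of a dominating set. -/
noncomputable def domNum {V : Type*} [Fintype V] (G : SimpleGraph V) : ℕ :=
  sInf {k | ∃ D : Finset V, IsDomSet G ↑D ∧ D.card = k}

/-- Every prefix `{v_0, …, v_i}` of the revelation order induces a connected subgraph.
(The input graph is presented on `Fin n`, vertex `i` being revealed at time `i`.) -/
def PrefixConnected {n : ℕ} (G : SimpleGraph (Fin n)) : Prop :=
  ∀ i : Fin n, (SimpleGraph.induce {v : Fin n | v ≤ i} G).Connected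

/-- Closed neighborhood of a finite set of vertices. -/
noncomputable def closedN {n : ℕ} (G : SimpleGraph (Fin n)) (A : Finset (Fin n)) :
    Finset (Fin n) :=
  Finset.univ.filter fun v => v ∈ A ∨ ∃ u ∈ A, G.Adj u v

/-- `R_i`: the vertices revealed by time `i`. -/
noncomputable def Rset (n : ℕ) (i : ℕ) : Finset (Fin n) :=
  Finset.univ.filter fun v => (v : ℕ) ≤ i

/-- `U_i`: visible vertices undominated just before the decision at time `i`,
given the set `Sprev` of previously selected vertices. -/
noncomputable def Uset {n : ℕ} (G : SimpleGraph (Fin n)) (i : ℕ) (Sprev : Finset (Fin n)) :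
    Finset (Fin n) :=
  closedN G (Rset n i) \ closedN G Sprev

/-- The open neighborhood of a vertex, as a finset. -/
noncomputable def nbrs {n : ℕ} (G : SimpleGraph (Fin n)) (v : Fin n) : Finset (Fin n) :=
  Finset.univ.filter fun w => G.Adj v w

/-- The degree of a vertex. -/
noncomputable def deg {n : ℕ} (G : SimpleGraph (Fin n)) (v : Fin n) : ℕ := (nbrs G v).card

/-- `vj` saves `vm`: `vj` is the last vertex of `N[vm]` in the revelation order and
`N[vm] \ {vj}` contains no previously selected vertex. -/
def Saves {n : ℕ} (G : SimpleGraph (Fin n)) (Sprev : Finset (Fin n)) (vj vm : Fin n) : Prop :=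
  (vj = vm ∨ G.Adj vm vj) ∧
  (∀ w : Fin n, (w = vm ∨ G.Adj vm w) → (w : ℕ) ≤ (vj : ℕ)) ∧
  (∀ w : Fin n, (w = vm ∨ G.Adj vm w) → w ≠ vj → w ∉ Sprev)

/-- Decision of `k`-DOMINATE at vertex `vi` with previously selected set `Sprev`:
select iff `vi` has at least `k` undominated neighbors, or `vi` saves some vertex. -/
def kDomDecision {n : ℕ} (G : SimpleGraph (Fin n)) (k : ℕ) (vi : Fin n)
    (Sprev : Finset (Fin n)) : Prop :=
  k ≤ (nbrs G vi ∩ Uset G (vi : ℕ) Sprev).card ∨ ∃ vm : Fin n, Saves G Sprev vi vm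

/-- The set of vertices selected by `k`-DOMINATE after the first `i` decisions. -/
noncomputable def kDomStep {n : ℕ} (G : SimpleGraph (Fin n)) (k : ℕ) : ℕ → Finset (Fin n)
  | 0 => ∅
  | i + 1 =>
    kDomStep G k i ∪
      if h : i < n then
        if kDomDecision G k ⟨i, h⟩ (kDomStep G k i) then {⟨i, h⟩} else ∅
      else ∅

/-- The output of the online algorithm `k`-DOMINATE. -/
noncomputable def kDomOutput {n : ℕ} (G : SimpleGraph (Fin n)) (k : ℕ) : Finset (Fin n) :=
  kDomStep G k n

theorem kDomStep_mono {n : ℕ} (G : SimpleGraph (Fin n)) (k : ℕ) : Monotone (kDomStep G k) := by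
  apply monotone_nat_of_le_succ
  intro i
  rw [kDomStep]
  exact Finset.subset_union_left

theorem mem_step_of_heavy {n : ℕ} (G : SimpleGraph (Fin n)) (k : ℕ) (v : Fin n)
    (h : k ≤ (nbrs G v ∩ Uset G (v : ℕ) (kDomStep G k (v : ℕ))).card) (j : ℕ)
    (hj : (v : ℕ) < j) : v ∈ kDomStep G k j := by
  apply kDomStep_mono G k (Nat.succ_le_of_lt hj)
  rw [Nat.succ_eq_add_one, kDomStep]
  have hd : kDomDecision G k ⟨(v : ℕ), v.2⟩ (kDomStep G k (v : ℕ)) := Or.inl h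
  apply Finset.mem_union_right
  rw [dif_pos v.2, if_pos hd]
  simp

theorem heavy_disjoint {n : ℕ} (G : SimpleGraph (Fin n)) (k : ℕ) (v w : Fin n)
    (h : k ≤ (nbrs G v ∩ Uset G (v : ℕ) (kDomStep G k (v : ℕ))).card) (hj : v < w) :
    Disjoint (nbrs G v ∩ Uset G (v : ℕ) (kDomStep G k (v : ℕ)))
      (nbrs G w ∩ Uset G (w : ℕ) (kDomStep G k (w : ℕ))) := by
  rw [Finset.disjoint_left]
  intro x hx hx'
  have h1 := mem_step_of_heavy G k v h w hj
  have h2 : G.Adj v x := by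
    have := (Finset.mem_inter.1 hx).1
    simpa [nbrs] using this
  have h3 := (Finset.mem_inter.1 hx').2
  rw [Uset, Finset.mem_sdiff] at h3
  apply h3.2
  simp only [closedN, Finset.mem_filter, Finset.mem_univ, true_and]
  exact Or.inr ⟨v, h1, h2⟩

theorem card_le_domNum {n : ℕ} (G : SimpleGraph (Fin n)) (Δ : ℕ) (hdeg : ∀ v, deg G v ≤ Δ) :
    n ≤ domNum G * (Δ + 1) := by
  have hne : {k | ∃ D : Finset (Fin n), IsDomSet G ↑D ∧ D.card = k}.Nonempty :=
    ⟨_, Finset.univ, fun v => Or.inl (by simp), rfl⟩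
  obtain ⟨D, hD, hc⟩ := Nat.sInf_mem hne
  have hsub : (Finset.univ : Finset (Fin n)) ⊆ D.biUnion (fun v => insert v (nbrs G v)) := by
    intro x _
    rw [Finset.mem_biUnion]
    rcases hD x with h | ⟨u, hu, ha⟩
    · exact ⟨x, by simpa using h, Finset.mem_insert_self _ _⟩
    · exact ⟨u, by simpa using hu, Finset.mem_insert_of_mem (by simpa [nbrs] using ha)⟩
  have h1 := Finset.card_le_card hsub
  have h2 := Finset.card_biUnion_le_card_mul D (fun v => insert v (nbrs G v)) (Δ + 1)
    (fun v _ => (Finset.card_insert_le _ _).trans (Nat.succ_le_succ (hdeg v)))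
  rw [Finset.card_univ, Fintype.card_fin] at h1
  unfold domNum
  rw [← hc]
  exact h1.trans h2

/-- Running `⌈√Δ⌉`-DOMINATE on a connected graph of maximum degree at
most `Δ` (revealed with connected prefixes), the number of heavy selected vertices—those
selected vertices `v_i` with at least `⌈√Δ⌉` undominated neighbors at their arrival—is at
most `(√Δ + 1/√Δ)·γ(G)`. -/
theorem heavy_vertices_bound (Δ : ℕ) (hΔ : 2 ≤ Δ) {n : ℕ}
    (G : SimpleGraph (Fin n)) (hconn : G.Connected) (hdeg : ∀ v, deg G v ≤ Δ)
    (hpc : PrefixConnected G) :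
    (((Finset.univ.filter fun v : Fin n =>
          v ∈ kDomOutput G ⌈Real.sqrt Δ⌉₊ ∧
          ⌈Real.sqrt Δ⌉₊ ≤
            (nbrs G v ∩ Uset G (v : ℕ) (kDomStep G ⌈Real.sqrt Δ⌉₊ (v : ℕ))).card).card : ℝ))
      ≤ (Real.sqrt Δ + 1 / Real.sqrt Δ) * (domNum G : ℝ) := by
  set k := ⌈Real.sqrt Δ⌉₊ with hk
  set H := (Finset.univ.filter fun v : Fin n => v ∈ kDomOutput G k ∧
    k ≤ (nbrs G v ∩ Uset G (v : ℕ) (kDomStep G k (v : ℕ))).card) with hH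
  have hheavy : ∀ v ∈ H, k ≤ (nbrs G v ∩ Uset G (v : ℕ) (kDomStep G k (v : ℕ))).card := by
    intro v hv
    exact (Finset.mem_filter.1 hv).2.2
  have hdisj : (H : Set (Fin n)).PairwiseDisjoint
      (fun v => nbrs G v ∩ Uset G (v : ℕ) (kDomStep G k (v : ℕ))) := by
    intro v hv w hw hne
    rcases lt_or_gt_of_ne hne with h | h
    · exact heavy_disjoint G k v w (hheavy v hv) h
    · exact (heavy_disjoint G k w v (hheavy w hw) h).symm
  have h1 : H.card * k ≤ n := by
    have h2 := Finset.card_nsmul_le_sum H _ k hheavy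
    rw [← Finset.card_biUnion hdisj, smul_eq_mul] at h2
    exact h2.trans ((Finset.card_le_univ _).trans (by simp))
  have h3 : ((H.card * k : ℕ) : ℝ) ≤ ((domNum G * (Δ + 1) : ℕ) : ℝ) :=
    Nat.cast_le.2 (h1.trans (card_le_domNum G Δ hdeg))
  push_cast at h3
  have hpos : 0 < Real.sqrt Δ := Real.sqrt_pos.2 (by positivity)
  have hsq : Real.sqrt Δ * Real.sqrt Δ = Δ := Real.mul_self_sqrt (by positivity)
  have hle : Real.sqrt Δ ≤ k := Nat.le_ceil _
  have h4 : (H.card : ℝ) * Real.sqrt Δ ≤ domNum G * (Δ + 1) :=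
    (mul_le_mul_of_nonneg_left hle (by positivity)).trans h3
  have h5 : (Real.sqrt Δ + 1 / Real.sqrt Δ) * (domNum G : ℝ)
      = (domNum G * (Δ + 1)) / Real.sqrt Δ := by
    rw [← hsq]
    field_simp
    simp
    ring
  rw [h5, le_div_iff₀ hpos]
  exact h4
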